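/- Let H be an associative unital k-algebra, U a k-vector space with distinguished element 1_U, and let J, T, γ, η be linear maps satisfying the L-R-crossed product axioms (1)-(13). Then the L-R-crossed product multiplication on U⊗H is associative and has 1_U⊗1_H as a two-sided unit; that is, U⊗H becomes an associative unital k-algebra (denoted U ♮_{J,T,γ,η} H). -/

import Mathlib

open TensorProduct LinearMap

noncomputable section

variable {k : Type*} [Field k]

section Helpers

variable {M N P Q : Type*}
  [AddCommMonoid M] [AddCommMonoid N] [AddCommMonoid P] [AddCommMonoid Q]
  [Module k M] [Module k N] [Module k P] [Module k Q]

def aso : (M ⊗[k] N) ⊗[k] P →ₗ[k] M ⊗[k] (N ⊗[k] P) :=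
  (TensorProduct.assoc k M N P).toLinearMap

def osa : M ⊗[k] (N ⊗[k] P) →ₗ[k] (M ⊗[k] N) ⊗[k] P :=
  (TensorProduct.assoc k M N P).symm.toLinearMap

def cc : M ⊗[k] N →ₗ[k] N ⊗[k] M := (TensorProduct.comm k M N).toLinearMap

def lc : M ⊗[k] (N ⊗[k] P) →ₗ[k] N ⊗[k] (M ⊗[k] P) :=
  (TensorProduct.leftComm k M N P).toLinearMap

def tt : (M ⊗[k] N) ⊗[k] (P ⊗[k] Q) →ₗ[k] (M ⊗[k] P) ⊗[k] (N ⊗[k] Q) :=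
  (TensorProduct.tensorTensorTensorComm k M N P Q).toLinearMap

end Helpers

section LRCrossed

variable (k)
variable (H U : Type*) [Ring H] [Algebra k H] [AddCommGroup U] [Module k U]

abbrev mH : H ⊗[k] H →ₗ[k] H := LinearMap.mul' k H

def dR : (H ⊗[k] H) ⊗[k] H →ₗ[k] H ⊗[k] H :=
  rTensor H (mH k H) ∘ₗ osa ∘ₗ lTensor H cc ∘ₗ aso

/-- `d ⊗ (g ⊗ i) ↦ (d*g) ⊗ i`. -/
def dL : H ⊗[k] (H ⊗[k] H) →ₗ[k] H ⊗[k] H :=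
  rTensor H (mH k H) ∘ₗ osa

/-- `(g ⊗ i) ⊗ d ↦ g ⊗ (d*i)`. -/
def eR : (H ⊗[k] H) ⊗[k] H →ₗ[k] H ⊗[k] H :=
  lTensor H ((mH k H) ∘ₗ cc) ∘ₗ aso

/-- `d ⊗ (g ⊗ i) ↦ g ⊗ (i*d)`. -/
def eL : H ⊗[k] (H ⊗[k] H) →ₗ[k] H ⊗[k] H :=
  lTensor H ((mH k H) ∘ₗ cc) ∘ₗ lc

/-- `(g ⊗ i) ⊗ (a ⊗ b) ↦ (g*a) ⊗ (b*i)`. -/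
def mulLR : (H ⊗[k] H) ⊗[k] (H ⊗[k] H) →ₗ[k] H ⊗[k] H :=
  TensorProduct.map (mH k H) ((mH k H) ∘ₗ cc) ∘ₗ tt


def w12 : H ⊗[k] (H ⊗[k] H) →ₗ[k] H ⊗[k] H :=
  lTensor H ((mH k H) ∘ₗ cc) ∘ₗ lc ∘ₗ lTensor H cc

def inner12 : (H ⊗[k] H) ⊗[k] (H ⊗[k] H) →ₗ[k] H ⊗[k] H :=
  lTensor H ((mH k H) ∘ₗ cc) ∘ₗ aso ∘ₗ lTensor (H ⊗[k] H) ((mH k H) ∘ₗ cc)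

/-- `(g ⊗ i) ⊗ (b ⊗ (d ⊗ e)) ↦ g * d * e * b * i`. -/
def omegaM : (H ⊗[k] H) ⊗[k] (H ⊗[k] (H ⊗[k] H)) →ₗ[k] H :=
  (mH k H) ∘ₗ
    TensorProduct.map (mH k H) ((mH k H) ∘ₗ rTensor H (mH k H) ∘ₗ cc) ∘ₗ
    tt ∘ₗ lTensor (H ⊗[k] H) (lTensor H cc ∘ₗ lc)

variable {H U}
variable (J : H ⊗[k] U →ₗ[k] U ⊗[k] H) (T : U ⊗[k] H →ₗ[k] U ⊗[k] H)
variable (γ : U ⊗[k] U →ₗ[k] U ⊗[k] (U ⊗[k] H))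
variable (η : U ⊗[k] U →ₗ[k] U ⊗[k] (H ⊗[k] H))

variable (oneU : U)

/-- Axiom (1): `J(h ⊗ 1_U) = 1_U ⊗ h` and `J(1_H ⊗ u) = u ⊗ 1_H`. -/
def LRax1 : Prop :=
  (∀ h : H, J (h ⊗ₜ oneU) = oneU ⊗ₜ h) ∧ (∀ u : U, J ((1 : H) ⊗ₜ u) = u ⊗ₜ (1 : H))

/-- Axiom (2): `T(u ⊗ 1_H) = u ⊗ 1_H` and `T(1_U ⊗ h) = 1_U ⊗ h`. -/
def LRax2 : Prop :=
  (∀ u : U, T (u ⊗ₜ (1 : H)) = u ⊗ₜ (1 : H)) ∧ (∀ h : H, T (oneU ⊗ₜ h) = oneU ⊗ₜ h)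

/-- Axiom (3): `γ(u ⊗ 1_U) = u ⊗ 1_U ⊗ 1_H` and `γ(1_U ⊗ u) = 1_U ⊗ u ⊗ 1_H`. -/
def LRax3 : Prop :=
  (∀ u : U, γ (u ⊗ₜ oneU) = u ⊗ₜ (oneU ⊗ₜ (1 : H))) ∧
  (∀ u : U, γ (oneU ⊗ₜ u) = oneU ⊗ₜ (u ⊗ₜ (1 : H)))

/-- Axiom (4): `η(u ⊗ 1_U) = η(1_U ⊗ u) = u ⊗ 1_H ⊗ 1_H`. -/
def LRax4 : Prop :=
  (∀ u : U, η (u ⊗ₜ oneU) = u ⊗ₜ ((1 : H) ⊗ₜ (1 : H))) ∧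
  (∀ u : U, η (oneU ⊗ₜ u) = u ⊗ₜ ((1 : H) ⊗ₜ (1 : H)))

/-- Axiom (5): `u_J ⊗ (hh')_J = (u_J)_j ⊗ h_j h'_J`. -/
def LRax5 : Prop := ∀ (h h' : H) (u : U),
  J ((h * h') ⊗ₜ u) =
    lTensor U (mH k H) (aso (rTensor H J (osa (h ⊗ₜ (J (h' ⊗ₜ u))))))

/-- Axiom (6): `u_T ⊗ (hh')_T = (u_T)_t ⊗ h_T h'_t`. -/
def LRax6 : Prop := ∀ (u : U) (h h' : H),
  T (u ⊗ₜ (h * h')) =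
    lTensor U ((mH k H) ∘ₗ cc)
      (aso (rTensor H T (osa (lTensor U cc (aso ((T (u ⊗ₜ h)) ⊗ₜ h'))))))

/-- Axiom (7):
`η₁(u_J,u'_j) ⊗ η₂(u_J,u'_j)(h_J)_j ⊗ η₃(u_J,u'_j) = η₁(u,u')_J ⊗ h_J η₂(u,u') ⊗ η₃(u,u')`. -/
def LRax7 : Prop := ∀ (h : H) (u u' : U),
  lTensor U (dR k H)
      (aso (rTensor H η (osa (lTensor U J (aso ((J (h ⊗ₜ u)) ⊗ₜ u'))))))
  = lTensor U (dL k H)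
      (aso (rTensor (H ⊗[k] H) J (osa (h ⊗ₜ (η (u ⊗ₜ u'))))))

/-- Axiom (8):
`η₁(u_t,u'_T) ⊗ η₂(u_t,u'_T) ⊗ (h_T)_t η₃(u_t,u'_T) = η₁(u,u')_T ⊗ η₂(u,u') ⊗ η₃(u,u')h_T`. -/
def LRax8 : Prop := ∀ (u u' : U) (h : H),
  lTensor U (eR k H)
      (aso (rTensor H η (osa (lTensor U cc
        (aso (rTensor U T (osa (lTensor U cc (u ⊗ₜ (T (u' ⊗ₜ h)))))))))))
  = lTensor U (eL k H)
      (aso (rTensor (H ⊗[k] H) T (osa (lTensor U cc (aso ((η (u ⊗ₜ u')) ⊗ₜ h))))))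

/-- Axiom (9). -/
def LRax9 : Prop := ∀ (u u' u'' : U),
  lTensor U (mulLR k H)
      (aso (rTensor (H ⊗[k] H) η (osa (lTensor U (aso (P := H))
        ((lTensor U (rTensor H J ∘ₗ osa ∘ₗ lTensor H cc ∘ₗ aso))
          (aso ((η (u ⊗ₜ u')) ⊗ₜ u'')))))))
  = lTensor U ((mulLR k H) ∘ₗ lTensor (H ⊗[k] H) cc)
      (aso (rTensor (H ⊗[k] H) η (tt (rTensor (U ⊗[k] H) T
        (osa (lTensor U (lc ∘ₗ lTensor U cc) (u ⊗ₜ (η (u' ⊗ₜ u'')))))))))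


def qJ : (U ⊗[k] H) ⊗[k] H →ₗ[k] U ⊗[k] H :=
  lTensor U (mH k H) ∘ₗ aso ∘ₗ rTensor H J ∘ₗ osa ∘ₗ lc ∘ₗ lTensor U cc ∘ₗ aso

/-- Axiom (10). -/
def LRax10 : Prop := ∀ (u u' : U) (h : H),
  lTensor U (lTensor U ((mH k H) ∘ₗ cc))
      (aso (tt (rTensor (U ⊗[k] H) T (osa (lTensor U cc
        (aso (rTensor H γ (osa (u ⊗ₜ (J (h ⊗ₜ u')))))))))))
  = lTensor U (qJ k J)
      (aso (rTensor H γ (osa (lTensor U cc (aso ((T (u ⊗ₜ h)) ⊗ₜ u'))))))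

def psi11 : (U ⊗[k] H) ⊗[k] (H ⊗[k] H) →ₗ[k] U ⊗[k] (H ⊗[k] H) :=
  lTensor U (rTensor H (mH k H) ∘ₗ osa) ∘ₗ aso

def chainX : (U ⊗[k] H) ⊗[k] (U ⊗[k] H) →ₗ[k] U ⊗[k] (H ⊗[k] H) :=
  (lTensor U ((dR k H) ∘ₗ lTensor (H ⊗[k] H) (mH k H))) ∘ₗ aso ∘ₗ
    rTensor (H ⊗[k] H) η ∘ₗ rTensor (H ⊗[k] H) cc ∘ₗ tt ∘ₗ
    lTensor (U ⊗[k] H) cc ∘ₗ rTensor (H ⊗[k] U) J ∘ₗ rTensor (H ⊗[k] U) cc ∘ₗ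
    tt ∘ₗ lTensor (U ⊗[k] H) cc

/-- Axiom (11). -/
def LRax11 : Prop := ∀ (u u' u'' : U),
  lTensor U (psi11 k)
      (aso (tt (rTensor ((U ⊗[k] H) ⊗[k] H) T (tt (rTensor (H ⊗[k] H) γ
        (osa (u ⊗ₜ (η (u' ⊗ₜ u'')))))))))
  = lTensor U (chainX k J η)
      (aso (rTensor (U ⊗[k] H) γ (osa (lTensor U cc
        (aso ((γ (u ⊗ₜ u')) ⊗ₜ u''))))))

def chain12 : (U ⊗[k] H) ⊗[k] (H ⊗[k] H) →ₗ[k] U ⊗[k] (H ⊗[k] H) :=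
  (lTensor U (w12 k H)) ∘ₗ aso ∘ₗ tt ∘ₗ rTensor (H ⊗[k] H) J ∘ₗ
    rTensor (H ⊗[k] H) cc ∘ₗ tt ∘ₗ lTensor (U ⊗[k] H) cc

def big12 : (H ⊗[k] H) ⊗[k] (H ⊗[k] (U ⊗[k] H)) →ₗ[k] U ⊗[k] (H ⊗[k] H) :=
  lTensor U (inner12 k H) ∘ₗ lc ∘ₗ lTensor (H ⊗[k] H) lc

/-- Axiom (12). -/
def LRax12 : Prop := ∀ (u u' u'' : U),
  lTensor U (chain12 k J)
      (aso (rTensor (H ⊗[k] H) γ (osa (lTensor U cc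
        (aso ((η (u ⊗ₜ u')) ⊗ₜ u''))))))
  = lTensor U (big12 k)
      (aso (rTensor (H ⊗[k] (U ⊗[k] H)) η (tt (lTensor (U ⊗[k] H) cc
        (rTensor ((U ⊗[k] H) ⊗[k] U) T (tt (lTensor (U ⊗[k] (U ⊗[k] H)) cc
          (rTensor (U ⊗[k] H) γ (osa (lTensor U lc (u ⊗ₜ (γ (u' ⊗ₜ u'')))))))))))))

def w13 : H ⊗[k] (U ⊗[k] H) →ₗ[k] U ⊗[k] H :=
  lTensor U ((mH k H) ∘ₗ cc) ∘ₗ lc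

def xi2 : H ⊗[k] (U ⊗[k] H) →ₗ[k] U ⊗[k] H :=
  lTensor U (mH k H) ∘ₗ aso ∘ₗ rTensor H J ∘ₗ osa

def xi : H ⊗[k] (U ⊗[k] (U ⊗[k] H)) →ₗ[k] U ⊗[k] (U ⊗[k] H) :=
  lTensor U (xi2 k J) ∘ₗ lc

def rho : (U ⊗[k] H) ⊗[k] U →ₗ[k] (U ⊗[k] (U ⊗[k] H)) ⊗[k] H :=
  rTensor H γ ∘ₗ osa ∘ₗ lTensor U cc ∘ₗ aso

def chainR : ((U ⊗[k] (U ⊗[k] H)) ⊗[k] H) ⊗[k] H →ₗ[k] (U ⊗[k] H) ⊗[k] (U ⊗[k] H) :=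
  tt ∘ₗ lTensor (U ⊗[k] U) cc ∘ₗ
    lTensor (U ⊗[k] U) (rTensor H ((mH k H) ∘ₗ cc) ∘ₗ osa) ∘ₗ tt ∘ₗ
    lTensor (U ⊗[k] H) aso ∘ₗ rTensor ((U ⊗[k] H) ⊗[k] H) T ∘ₗ tt ∘ₗ
    lTensor (U ⊗[k] (U ⊗[k] H)) cc ∘ₗ aso

/-- The composite computing the right-hand side of axiom (13). -/
def rhs13 : ((H ⊗[k] (U ⊗[k] U)) ⊗[k] U) ⊗[k] H →ₗ[k]
    (U ⊗[k] (U ⊗[k] H)) ⊗[k] (U ⊗[k] H) :=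
  osa ∘ₗ lTensor U (chainR k T) ∘ₗ aso ∘ₗ
    rTensor H (lTensor U (rho k γ) ∘ₗ aso ∘ₗ rTensor U ((xi k J) ∘ₗ lTensor H γ))

/-- Axiom (13). -/
def LRax13 : Prop := ∀ (u u' u'' : U) (h h' : H),
  rTensor (U ⊗[k] H) (xi k J)
      (osa (h' ⊗ₜ (lTensor (U ⊗[k] (U ⊗[k] H)) (w13 k)
        (aso (rTensor (U ⊗[k] H) (rTensor H γ) (rTensor (U ⊗[k] H) osa
          (osa (u ⊗ₜ (rTensor (U ⊗[k] H) T (osa (lTensor U cc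
            (aso ((γ (u' ⊗ₜ u'')) ⊗ₜ h)))))))))))))
  = rhs13 k J T γ (((h' ⊗ₜ (u ⊗ₜ u')) ⊗ₜ u'') ⊗ₜ h)

/-- The L-R-crossed product multiplication, as a linear map. -/
def lrM : (U ⊗[k] H) ⊗[k] (U ⊗[k] H) →ₗ[k] U ⊗[k] H :=
  lTensor U (omegaM k H) ∘ₗ aso ∘ₗ rTensor (H ⊗[k] (H ⊗[k] H)) η ∘ₗ tt ∘ₗ
    lTensor (U ⊗[k] H) aso ∘ₗ rTensor ((U ⊗[k] H) ⊗[k] H) T ∘ₗ tt ∘ₗ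
    lTensor (U ⊗[k] (U ⊗[k] H)) cc ∘ₗ
    rTensor (H ⊗[k] H) (lTensor U J ∘ₗ lTensor U cc ∘ₗ aso) ∘ₗ tt ∘ₗ
    rTensor (H ⊗[k] H) (osa ∘ₗ γ) ∘ₗ tt

/-- The L-R-crossed product multiplication of two elements of `U ⊗ H`. -/
def lrMul (x y : U ⊗[k] H) : U ⊗[k] H := lrM k J T γ η (x ⊗ₜ y)

end LRCrossed

section Sweedler

section Sums

variable {M N P M' N' P' X : Type*}
  [AddCommMonoid M] [AddCommMonoid N] [AddCommMonoid P]
  [AddCommMonoid M'] [AddCommMonoid N'] [AddCommMonoid P'] [AddCommMonoid X]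
  [Module k M] [Module k N] [Module k P] [Module k M'] [Module k N'] [Module k P']

/-- The sum of `f m n` over a chosen decomposition of `t` into pure tensors `m ⊗ n`. -/
def sweedler₂ (t : M ⊗[k] N) (f : M → N → X) : X :=
  ∑ p ∈ (TensorProduct.exists_finset t).choose, f p.1 p.2

/-- The sum of `f m n p` over a chosen decomposition of `t` into pure tensors `m ⊗ n ⊗ p`. -/
def sweedler₃ (t : M ⊗[k] (N ⊗[k] P)) (f : M → N → P → X) : X :=
  sweedler₂ t fun m s => sweedler₂ s fun n p => f m n p

theorem sweedler₂_congr {t : M ⊗[k] N} {f g : M → N → X} (h : ∀ m n, f m n = g m n) :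
    sweedler₂ t f = sweedler₂ t g := by
  rw [funext fun m => funext (h m)]

theorem sweedler₃_congr {t : M ⊗[k] (N ⊗[k] P)} {f g : M → N → P → X}
    (h : ∀ m n p, f m n p = g m n p) : sweedler₃ t f = sweedler₃ t g := by
  rw [funext fun m => funext fun n => funext (h m n)]

theorem sweedler₂_comm (t : M ⊗[k] N) (s : M' ⊗[k] N') (f : M → N → M' → N' → X) :
    (sweedler₂ t fun m n => sweedler₂ s fun m' n' => f m n m' n') =
      sweedler₂ s fun m' n' => sweedler₂ t fun m n => f m n m' n' :=
  Finset.sum_comm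

theorem sweedler₂_sweedler₃_comm (t : M ⊗[k] N) (s : M' ⊗[k] (N' ⊗[k] P'))
    (f : M → N → M' → N' → P' → X) :
    (sweedler₂ t fun m n => sweedler₃ s fun m' n' p' => f m n m' n' p') =
      sweedler₃ s fun m' n' p' => sweedler₂ t fun m n => f m n m' n' p' :=
  (sweedler₂_comm _ _ _).trans <| sweedler₂_congr fun _ _ => sweedler₂_comm _ _ _

theorem sweedler₃_comm (t : M ⊗[k] (N ⊗[k] P)) (s : M' ⊗[k] (N' ⊗[k] P'))
    (f : M → N → P → M' → N' → P' → X) :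
    (sweedler₃ t fun m n p => sweedler₃ s fun m' n' p' => f m n p m' n' p') =
      sweedler₃ s fun m' n' p' => sweedler₃ t fun m n p => f m n p m' n' p' :=
  (sweedler₂_congr fun _ _ => sweedler₂_sweedler₃_comm _ _ _).trans <|
    sweedler₂_sweedler₃_comm _ _ _

end Sums

section Linear

variable {M N P X Y Z A : Type*}
  [AddCommMonoid M] [AddCommMonoid N] [AddCommMonoid P]
  [AddCommMonoid X] [AddCommMonoid Y] [AddCommMonoid Z] [Semiring A]
  [Module k M] [Module k N] [Module k P] [Module k X] [Module k Y] [Module k Z] [Algebra k A]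

variable (k) in
/-- `f` is `k`-linear, as a class so that linearity of nested Sweedler sums can be inferred. -/
class IsLin (f : X → Y) : Prop where
  isLinearMap : IsLinearMap k f

instance IsLin.id : IsLin k fun x : X => x := ⟨LinearMap.id.isLinear⟩

instance IsLin.linearMap_comp (L : Y →ₗ[k] Z) (f : X → Y) [hf : IsLin k f] :
    IsLin k fun x => L (f x) :=
  ⟨(L ∘ₗ hf.isLinearMap.mk' f).isLinear⟩

instance IsLin.linearMap (L : X →ₗ[k] Y) : IsLin k L := ⟨L.isLinear⟩

instance IsLin.mul_left (a : A) : IsLin k (HMul.hMul a : A → A) :=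
  IsLin.linearMap (LinearMap.mulLeft k a)

instance IsLin.tmul_left (z : Z) : IsLin k (TensorProduct.tmul k z : X → Z ⊗[k] X) :=
  IsLin.linearMap (TensorProduct.mk k Z X z)

instance IsLin.mul_const (f : X → A) (a : A) [IsLin k f] : IsLin k fun x => f x * a :=
  IsLin.linearMap_comp (LinearMap.mulRight k a) f

instance IsLin.const_mul (f : X → A) (a : A) [IsLin k f] : IsLin k fun x => a * f x :=
  IsLin.linearMap_comp (LinearMap.mulLeft k a) f

instance IsLin.tmul_const (f : X → Y) (z : Z) [IsLin k f] : IsLin k fun x => f x ⊗ₜ[k] z :=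
  IsLin.linearMap_comp ((TensorProduct.mk k Y Z).flip z) f

instance IsLin.const_tmul (f : X → Y) (z : Z) [IsLin k f] : IsLin k fun x => z ⊗ₜ[k] f x :=
  IsLin.linearMap_comp (TensorProduct.mk k Z Y z) f

theorem map_sweedler₂ (g : X → Y) [hg : IsLin k g] (t : M ⊗[k] N) (f : M → N → X) :
    g (sweedler₂ t f) = sweedler₂ t fun m n => g (f m n) :=
  map_sum (hg.isLinearMap.mk' g) _ _

theorem map_sweedler₃ (g : X → Y) [IsLin k g] (t : M ⊗[k] (N ⊗[k] P)) (f : M → N → P → X) :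
    g (sweedler₃ t f) = sweedler₃ t fun m n p => g (f m n p) := by
  simp only [sweedler₃, map_sweedler₂ (k := k) g]

theorem sweedler₂_eq (t : M ⊗[k] N) {f : M → N → X} {g : M ⊗[k] N → X} [hg : IsLin k g]
    (h : ∀ m n, f m n = g (m ⊗ₜ n)) : sweedler₂ t f = g t := by
  conv_rhs => rw [(TensorProduct.exists_finset t).choose_spec]
  exact (Finset.sum_congr rfl fun p _ => h p.1 p.2).trans
    (map_sum (hg.isLinearMap.mk' g) _ _).symm

theorem sweedler₃_eq (t : M ⊗[k] (N ⊗[k] P)) {f : M → N → P → X} {g : M ⊗[k] (N ⊗[k] P) → X}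
    [hg : IsLin k g] (h : ∀ m n p, f m n p = g (m ⊗ₜ (n ⊗ₜ p))) : sweedler₃ t f = g t := by
  refine sweedler₂_eq t fun m s => ?_
  have : IsLin k fun s : N ⊗[k] P => g (m ⊗ₜ s) :=
    IsLin.linearMap_comp (hg.isLinearMap.mk' g) fun s => m ⊗ₜ[k] s
  exact sweedler₂_eq s (g := fun s => g (m ⊗ₜ s)) (h m)

theorem exists_lift (f : M → N → X) [h₁ : ∀ n, IsLin k fun m => f m n]
    [h₂ : ∀ m, IsLin k fun n => f m n] :
    ∃ L : M ⊗[k] N →ₗ[k] X, ∀ m n, f m n = L (m ⊗ₜ n) :=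
  ⟨TensorProduct.lift <| LinearMap.mk₂ k f
    (fun a b n => (h₁ n).isLinearMap.map_add a b) (fun c m n => (h₁ n).isLinearMap.map_smul c m)
    (fun m => (h₂ m).isLinearMap.map_add) (fun c m n => (h₂ m).isLinearMap.map_smul c n),
    fun _ _ => rfl⟩

@[simp]
theorem sweedler₂_tmul (f : M → N → X) (m : M) (n : N) [∀ n, IsLin k fun m => f m n]
    [∀ m, IsLin k fun n => f m n] : sweedler₂ (m ⊗ₜ[k] n) f = f m n := by
  obtain ⟨L, hL⟩ := exists_lift (k := k) f
  rw [hL]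
  exact sweedler₂_eq _ hL

instance IsLin.sweedler₂_left (t : X → M ⊗[k] N) (f : M → N → Y) [IsLin k t]
    [∀ n, IsLin k fun m => f m n] [∀ m, IsLin k fun n => f m n] :
    IsLin k fun x => sweedler₂ (t x) fun m n => f m n := by
  obtain ⟨L, hL⟩ := exists_lift (k := k) f
  have : (fun x => sweedler₂ (t x) f) = fun x => L (t x) := funext fun x => sweedler₂_eq _ hL
  exact this ▸ inferInstance

instance IsLin.sweedler₂_right (t : M ⊗[k] N) (f : X → M → N → Y)
    [h : ∀ m n, IsLin k fun x => f x m n] : IsLin k fun x => sweedler₂ t fun m n => f x m n where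
  isLinearMap :=
    { map_add := fun a b => by
        simp only [sweedler₂, (h _ _).isLinearMap.map_add, Finset.sum_add_distrib]
      map_smul := fun c a => by
        simp only [sweedler₂, (h _ _).isLinearMap.map_smul, Finset.smul_sum] }

instance IsLin.sweedler₃_left (t : X → M ⊗[k] (N ⊗[k] P)) (f : M → N → P → Y) [IsLin k t]
    [∀ n p, IsLin k fun m => f m n p] [∀ m p, IsLin k fun n => f m n p]
    [∀ m n, IsLin k fun p => f m n p] :
    IsLin k fun x => sweedler₃ (t x) fun m n p => f m n p :=
  inferInstanceAs (IsLin k fun x => sweedler₂ (t x) fun m s => sweedler₂ s fun n p => f m n p)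

instance IsLin.sweedler₃_right (t : M ⊗[k] (N ⊗[k] P)) (f : X → M → N → P → Y)
    [∀ m n p, IsLin k fun x => f x m n p] :
    IsLin k fun x => sweedler₃ t fun m n p => f x m n p :=
  inferInstanceAs (IsLin k fun x => sweedler₂ t fun m s => sweedler₂ s fun n p => f x m n p)

@[simp]
theorem sweedler₃_tmul (f : M → N → P → X) (m : M) (n : N) (p : P)
    [∀ n p, IsLin k fun m => f m n p] [∀ m p, IsLin k fun n => f m n p]
    [∀ m n, IsLin k fun p => f m n p] : sweedler₃ (m ⊗ₜ[k] (n ⊗ₜ[k] p)) f = f m n p := by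
  rw [sweedler₃, sweedler₂_tmul, sweedler₂_tmul]

end Linear

section Structural

variable {M N P Q : Type*}
  [AddCommMonoid M] [AddCommMonoid N] [AddCommMonoid P] [AddCommMonoid Q]
  [Module k M] [Module k N] [Module k P] [Module k Q]

@[simp]
theorem aso_tmul (m : M) (n : N) (p : P) :
    aso (k := k) ((m ⊗ₜ[k] n) ⊗ₜ[k] p) = m ⊗ₜ[k] (n ⊗ₜ[k] p) := rfl

@[simp]
theorem osa_tmul (m : M) (n : N) (p : P) :
    osa (k := k) (m ⊗ₜ[k] (n ⊗ₜ[k] p)) = (m ⊗ₜ[k] n) ⊗ₜ[k] p := rfl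

@[simp]
theorem cc_tmul (m : M) (n : N) : cc (k := k) (m ⊗ₜ[k] n) = n ⊗ₜ[k] m := rfl

@[simp]
theorem lc_tmul (m : M) (n : N) (p : P) :
    lc (k := k) (m ⊗ₜ[k] (n ⊗ₜ[k] p)) = n ⊗ₜ[k] (m ⊗ₜ[k] p) := rfl

@[simp]
theorem tt_tmul (m : M) (n : N) (p : P) (q : Q) :
    tt (k := k) ((m ⊗ₜ[k] n) ⊗ₜ[k] (p ⊗ₜ[k] q)) = (m ⊗ₜ[k] p) ⊗ₜ[k] (n ⊗ₜ[k] q) := rfl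

end Structural

end Sweedler

section Axioms

variable {H U X : Type*} [Ring H] [Algebra k H] [AddCommGroup U] [Module k U]
  [AddCommMonoid X] [Module k X]
  {J : H ⊗[k] U →ₗ[k] U ⊗[k] H} {T : U ⊗[k] H →ₗ[k] U ⊗[k] H}
  {γ : U ⊗[k] U →ₗ[k] U ⊗[k] (U ⊗[k] H)} {η : U ⊗[k] U →ₗ[k] U ⊗[k] (H ⊗[k] H)}

theorem LRax5.sweedler (hax : LRax5 k J) (h h' : H) (u : U) (F : U → H → X)
    [∀ b, IsLin k fun a => F a b] [∀ a, IsLin k fun b => F a b] :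
    sweedler₂ (J ((h * h') ⊗ₜ u)) F =
      sweedler₂ (J (h' ⊗ₜ u)) fun u₁ h₁ =>
        sweedler₂ (J (h ⊗ₜ u₁)) fun u₂ h₂ => F u₂ (h₂ * h₁) := by
  rw [hax]
  symm
  generalize J (h' ⊗ₜ u) = t
  apply sweedler₂_eq
  intro u₁ h₁
  simp
  generalize J (h ⊗ₜ u₁) = t
  apply sweedler₂_eq
  intro u₂ h₂
  simp

theorem LRax6.sweedler (hax : LRax6 k T) (u : U) (h h' : H) (F : U → H → X)
    [∀ b, IsLin k fun a => F a b] [∀ a, IsLin k fun b => F a b] :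
    sweedler₂ (T (u ⊗ₜ (h * h'))) F =
      sweedler₂ (T (u ⊗ₜ h)) fun u₁ h₁ =>
        sweedler₂ (T (u₁ ⊗ₜ h')) fun u₂ h₂ => F u₂ (h₁ * h₂) := by
  rw [hax]
  symm
  generalize T (u ⊗ₜ h) = t
  apply sweedler₂_eq
  intro u₁ h₁
  simp
  generalize T (u₁ ⊗ₜ h') = t
  apply sweedler₂_eq
  intro u₂ h₂
  simp

theorem LRax7.sweedler (hax : LRax7 k J η) (h : H) (u u' : U) (F : U → H → H → X)
    [∀ b c, IsLin k fun a => F a b c] [∀ a c, IsLin k fun b => F a b c]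
    [∀ a b, IsLin k fun c => F a b c] :
    (sweedler₂ (J (h ⊗ₜ u)) fun b h₁ => sweedler₂ (J (h₁ ⊗ₜ u')) fun b' h₂ =>
      sweedler₃ (η (b ⊗ₜ b')) fun x y z => F x (y * h₂) z) =
      sweedler₃ (η (u ⊗ₜ u')) fun x y z => sweedler₂ (J (h ⊗ₜ x)) fun x' h₁ => F x' (h₁ * y) z := by
  unfold LRax7 dR dL at hax
  refine Eq.trans ?_ ((congrArg (fun t => sweedler₃ t F)
    (hax h u u')).trans (Eq.symm ?_))
  · generalize J (h ⊗ₜ u) = t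
    apply sweedler₂_eq
    intro b h₁
    simp
    generalize J (h₁ ⊗ₜ u') = t
    apply sweedler₂_eq
    intro b' h₂
    simp
    generalize η (b ⊗ₜ b') = t
    apply sweedler₃_eq
    intro x y z
    simp
  · generalize η (u ⊗ₜ u') = t
    apply sweedler₃_eq
    intro x y z
    simp
    generalize J (h ⊗ₜ x) = t
    apply sweedler₂_eq
    intro x' h₁
    simp

theorem LRax8.sweedler (hax : LRax8 k T η) (u u' : U) (h : H) (F : U → H → H → X)
    [∀ b c, IsLin k fun a => F a b c] [∀ a c, IsLin k fun b => F a b c]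
    [∀ a b, IsLin k fun c => F a b c] :
    (sweedler₂ (T (u' ⊗ₜ h)) fun a h₁ => sweedler₂ (T (u ⊗ₜ h₁)) fun a' h₂ =>
      sweedler₃ (η (a' ⊗ₜ a)) fun x y z => F x y (h₂ * z)) =
      sweedler₃ (η (u ⊗ₜ u')) fun x y z => sweedler₂ (T (x ⊗ₜ h)) fun x' h₁ => F x' y (z * h₁) := by
  unfold LRax8 eR eL at hax
  refine Eq.trans ?_ ((congrArg (fun t => sweedler₃ t F)
    (hax u u' h)).trans (Eq.symm ?_))
  · generalize T (u' ⊗ₜ h) = t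
    apply sweedler₂_eq
    intro a h₁
    simp
    generalize T (u ⊗ₜ h₁) = t
    apply sweedler₂_eq
    intro a' h₂
    simp
    generalize η (a' ⊗ₜ a) = t
    apply sweedler₃_eq
    intro x y z
    simp
  · generalize η (u ⊗ₜ u') = t
    apply sweedler₃_eq
    intro x y z
    simp
    generalize T (x ⊗ₜ h) = t
    apply sweedler₂_eq
    intro x' h₁
    simp

theorem LRax9.sweedler (hax : LRax9 k J T η) (u u' u'' : U) (F : U → H → H → X)
    [∀ b c, IsLin k fun a => F a b c] [∀ a c, IsLin k fun b => F a b c]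
    [∀ a b, IsLin k fun c => F a b c] :
    (sweedler₃ (η (u ⊗ₜ u')) fun x y z => sweedler₂ (J (y ⊗ₜ u'')) fun e y₁ =>
      sweedler₃ (η (x ⊗ₜ e)) fun p q r => F p (q * y₁) (z * r)) =
      sweedler₃ (η (u' ⊗ₜ u'')) fun x y z => sweedler₂ (T (u ⊗ₜ z)) fun u₁ z₁ =>
        sweedler₃ (η (u₁ ⊗ₜ x)) fun p q r => F p (q * y) (z₁ * r) := by
  unfold LRax9 mulLR at hax
  refine Eq.trans ?_ ((congrArg (fun t => sweedler₃ t F)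
    (hax u u' u'')).trans (Eq.symm ?_))
  · generalize η (u ⊗ₜ u') = t
    apply sweedler₃_eq
    intro x y z
    simp
    generalize J (y ⊗ₜ u'') = t
    apply sweedler₂_eq
    intro e y₁
    simp
    generalize η (x ⊗ₜ e) = t
    apply sweedler₃_eq
    intro p q r
    simp
  · generalize η (u' ⊗ₜ u'') = t
    apply sweedler₃_eq
    intro x y z
    simp
    generalize T (u ⊗ₜ z) = t
    apply sweedler₂_eq
    intro u₁ z₁
    simp
    generalize η (u₁ ⊗ₜ x) = t
    apply sweedler₃_eq
    intro p q r
    simp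

theorem LRax10.sweedler (hax : LRax10 k J T γ) (u u' : U) (h : H) (F : U → U → H → X)
    [∀ b c, IsLin k fun a => F a b c] [∀ a c, IsLin k fun b => F a b c]
    [∀ a b, IsLin k fun c => F a b c] :
    (sweedler₂ (J (h ⊗ₜ u')) fun b h₁ => sweedler₃ (γ (u ⊗ₜ b)) fun a c g =>
      sweedler₂ (T (a ⊗ₜ h₁)) fun a' h₂ => F a' c (g * h₂)) =
      sweedler₂ (T (u ⊗ₜ h)) fun a h₁ => sweedler₃ (γ (a ⊗ₜ u')) fun d e g =>
        sweedler₂ (J (h₁ ⊗ₜ e)) fun e' h₂ => F d e' (h₂ * g) := by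
  unfold LRax10 qJ at hax
  refine Eq.trans ?_ ((congrArg (fun t => sweedler₃ t F)
    (hax u u' h)).trans (Eq.symm ?_))
  · generalize J (h ⊗ₜ u') = t
    apply sweedler₂_eq
    intro b h₁
    simp
    generalize γ (u ⊗ₜ b) = t
    apply sweedler₃_eq
    intro a c g
    simp
    generalize T (a ⊗ₜ h₁) = t
    apply sweedler₂_eq
    intro a' h₂
    simp
  · generalize T (u ⊗ₜ h) = t
    apply sweedler₂_eq
    intro a h₁
    simp
    generalize γ (a ⊗ₜ u') = t
    apply sweedler₃_eq
    intro d e g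
    simp
    generalize J (h₁ ⊗ₜ e) = t
    apply sweedler₂_eq
    intro e' h₂
    simp

theorem LRax11.sweedler (hax : LRax11 k J T γ η) (u u' u'' : U) (F : U → U → H → H → X)
    [∀ b c d, IsLin k fun a => F a b c d] [∀ a c d, IsLin k fun b => F a b c d]
    [∀ a b d, IsLin k fun c => F a b c d] [∀ a b c, IsLin k fun d => F a b c d] :
    (sweedler₃ (η (u' ⊗ₜ u'')) fun x y z => sweedler₃ (γ (u ⊗ₜ x)) fun d e f =>
      sweedler₂ (T (d ⊗ₜ y)) fun d' y' => F d' e (f * y') z) =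
      sweedler₃ (γ (u ⊗ₜ u')) fun a b c => sweedler₃ (γ (a ⊗ₜ u'')) fun d e f =>
        sweedler₂ (J (c ⊗ₜ e)) fun e' c' => sweedler₃ (η (b ⊗ₜ e')) fun x y z =>
        F d x (y * (c' * f)) z := by
  unfold LRax11 psi11 chainX dR at hax
  refine Eq.trans ?_ ((congrArg (fun t => sweedler₃ t fun a b s => sweedler₂ s fun c d => F a b c d)
    (hax u u' u'')).trans (Eq.symm ?_))
  · generalize η (u' ⊗ₜ u'') = t
    apply sweedler₃_eq
    intro x y z
    simp
    generalize γ (u ⊗ₜ x) = t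
    apply sweedler₃_eq
    intro d e f
    simp
    generalize T (d ⊗ₜ y) = t
    apply sweedler₂_eq
    intro d' y'
    simp
  · generalize γ (u ⊗ₜ u') = t
    apply sweedler₃_eq
    intro a b c
    simp
    generalize γ (a ⊗ₜ u'') = t
    apply sweedler₃_eq
    intro d e f
    simp
    generalize J (c ⊗ₜ e) = t
    apply sweedler₂_eq
    intro e' c'
    simp
    generalize η (b ⊗ₜ e') = t
    apply sweedler₃_eq
    intro x y z
    simp

theorem LRax12.sweedler (hax : LRax12 k J T γ η) (u u' u'' : U) (F : U → U → H → H → X)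
    [∀ b c d, IsLin k fun a => F a b c d] [∀ a c d, IsLin k fun b => F a b c d]
    [∀ a b d, IsLin k fun c => F a b c d] [∀ a b c, IsLin k fun d => F a b c d] :
    (sweedler₃ (η (u ⊗ₜ u')) fun x y z => sweedler₃ (γ (x ⊗ₜ u'')) fun d e f =>
      sweedler₂ (J (z ⊗ₜ e)) fun e' z' => F d e' y (z' * f)) =
      sweedler₃ (γ (u' ⊗ₜ u'')) fun a b c => sweedler₃ (γ (u ⊗ₜ b)) fun d e f =>
        sweedler₂ (T (d ⊗ₜ c)) fun d' c' => sweedler₃ (η (d' ⊗ₜ a)) fun x y z =>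
        F x e y (f * c' * z) := by
  unfold LRax12 chain12 big12 w12 inner12 at hax
  refine Eq.trans ?_ ((congrArg (fun t => sweedler₃ t fun a b s => sweedler₂ s fun c d => F a b c d)
    (hax u u' u'')).trans (Eq.symm ?_))
  · generalize η (u ⊗ₜ u') = t
    apply sweedler₃_eq
    intro x y z
    simp
    generalize γ (x ⊗ₜ u'') = t
    apply sweedler₃_eq
    intro d e f
    simp
    generalize J (z ⊗ₜ e) = t
    apply sweedler₂_eq
    intro e' z'
    simp
  · generalize γ (u' ⊗ₜ u'') = t
    apply sweedler₃_eq
    intro a b c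
    simp
    generalize γ (u ⊗ₜ b) = t
    apply sweedler₃_eq
    intro d e f
    simp
    generalize T (d ⊗ₜ c) = t
    apply sweedler₂_eq
    intro d' c'
    simp
    generalize η (d' ⊗ₜ a) = t
    apply sweedler₃_eq
    intro x y z
    simp

theorem LRax13.sweedler (hax : LRax13 k J T γ) (u u' u'' : U) (h h' : H)
    (F : U → U → H → U → H → X)
    [∀ b c d e, IsLin k fun a => F a b c d e] [∀ a c d e, IsLin k fun b => F a b c d e]
    [∀ a b d e, IsLin k fun c => F a b c d e] [∀ a b c e, IsLin k fun d => F a b c d e]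
    [∀ a b c d, IsLin k fun e => F a b c d e] :
    (sweedler₃ (γ (u' ⊗ₜ u'')) fun a b c => sweedler₂ (T (a ⊗ₜ h)) fun a' k' =>
      sweedler₃ (γ (u ⊗ₜ a')) fun d e f => sweedler₂ (J (h' ⊗ₜ e)) fun e' h₁ =>
      F d e' (h₁ * f) b (c * k')) =
      sweedler₃ (γ (u ⊗ₜ u')) fun a b c => sweedler₂ (J (h' ⊗ₜ b)) fun b' h₁ =>
        sweedler₃ (γ (b' ⊗ₜ u'')) fun d e f => sweedler₂ (T (d ⊗ₜ h)) fun d' k' =>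
        F a d' (h₁ * c) e (f * k') := by
  unfold LRax13 rhs13 xi xi2 w13 rho chainR at hax
  refine Eq.trans ?_ ((congrArg (fun t => sweedler₂ t fun s r =>
      sweedler₃ s fun a b c => sweedler₂ r fun d e => F a b c d e)
    (hax u u' u'' h h')).trans (Eq.symm ?_))
  · generalize γ (u' ⊗ₜ u'') = t
    apply sweedler₃_eq
    intro a b c
    simp
    generalize T (a ⊗ₜ h) = t
    apply sweedler₂_eq
    intro a' k'
    simp
    generalize γ (u ⊗ₜ a') = t
    apply sweedler₃_eq
    intro d e f
    simp
    generalize J (h' ⊗ₜ e) = t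
    apply sweedler₂_eq
    intro e' h₁
    simp
  · simp
    generalize γ (u ⊗ₜ u') = t
    apply sweedler₃_eq
    intro a b c
    simp
    generalize J (h' ⊗ₜ b) = t
    apply sweedler₂_eq
    intro b' h₁
    simp
    generalize γ (b' ⊗ₜ u'') = t
    apply sweedler₃_eq
    intro d e f
    simp
    generalize T (d ⊗ₜ h) = t
    apply sweedler₂_eq
    intro d' k'
    simp

theorem lrM_tmul (u u' : U) (h h' : H) :
    lrM k J T γ η ((u ⊗ₜ h) ⊗ₜ (u' ⊗ₜ h')) =
      sweedler₃ (γ (u ⊗ₜ u')) fun a b c => sweedler₂ (T (a ⊗ₜ h')) fun a' h₁' =>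
        sweedler₂ (J (h ⊗ₜ b)) fun b' h₁ => sweedler₃ (η (a' ⊗ₜ b')) fun x y z =>
          x ⊗ₜ[k] (y * h₁ * c * h₁' * z) := by
  symm
  simp [lrM, omegaM]
  generalize γ (u ⊗ₜ u') = t
  apply sweedler₃_eq
  intro a b c
  simp
  rw [sweedler₂_comm]
  generalize J (h ⊗ₜ b) = t
  apply sweedler₂_eq
  intro b' h₁
  simp
  generalize T (a ⊗ₜ h') = t
  apply sweedler₂_eq
  intro a' h₁'
  simp
  generalize η (a' ⊗ₜ b') = t
  apply sweedler₃_eq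
  intro x y z
  simp [mul_assoc]

variable (J T γ η) in
/-- The part common to both ways of bracketing a triple product, after the two sides of
`LRax13` have been split off. -/
abbrev lrTail (h' : H) (a a' : U) (n : H) (b : U) (m : H) : U ⊗[k] H :=
  sweedler₂ (J (h' ⊗ₜ b)) fun b₁ l => sweedler₃ (γ (a ⊗ₜ b₁)) fun d e g =>
    sweedler₂ (J (n ⊗ₜ e)) fun e₁ n₁ => sweedler₃ (η (a' ⊗ₜ e₁)) fun s v w =>
    sweedler₂ (T (d ⊗ₜ (l * m * w))) fun d₁ m₁ => sweedler₃ (η (d₁ ⊗ₜ s)) fun p q r =>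
    p ⊗ₜ[k] (q * v * n₁ * g * m₁ * r)

set_option synthInstance.maxHeartbeats 400000 in
set_option synthInstance.maxSize 100000 in
/-- The product `(x ⊗ h) * (u'' ⊗ h'')` summed over the terms of the product of two pure tensors that
remain once `γ` and `J` have been expanded. -/
theorem lrM_lrM_left (hax5 : LRax5 k J) (hax6 : LRax6 k T) (hax8 : LRax8 k T η)
    (hax9 : LRax9 k J T η) (hax10 : LRax10 k J T γ) (hax12 : LRax12 k J T γ η)
    (a v u'' : U) (h' n h'' : H) :
    (sweedler₂ (T (a ⊗ₜ h')) fun a₁ l => sweedler₃ (η (a₁ ⊗ₜ v)) fun x y z =>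
      lrM k J T γ η ((x ⊗ₜ (y * n * l * z)) ⊗ₜ (u'' ⊗ₜ h''))) =
      sweedler₃ (γ (v ⊗ₜ u'')) fun A B C => sweedler₂ (T (A ⊗ₜ h'')) fun A₁ m =>
        lrTail J T γ η h' a A₁ n B (C * m) := by
  simp only [lrM_tmul]
  calc
    sweedler₂ (T (a ⊗ₜ h')) fun a₁ l => sweedler₃ (η (a₁ ⊗ₜ v)) fun x y z =>
        sweedler₃ (γ (x ⊗ₜ u'')) fun d e f => sweedler₂ (T (d ⊗ₜ h'')) fun d₁ m =>
        sweedler₂ (J ((y * n * l * z) ⊗ₜ e)) fun e₁ w => sweedler₃ (η (d₁ ⊗ₜ e₁)) fun p q r =>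
        p ⊗ₜ[k] (q * w * f * m * r)
    _ = sweedler₂ (T (a ⊗ₜ h')) fun a₁ l => sweedler₃ (η (a₁ ⊗ₜ v)) fun x y z =>
        sweedler₃ (γ (x ⊗ₜ u'')) fun d e f => sweedler₂ (T (d ⊗ₜ h'')) fun d₁ m =>
        sweedler₂ (J (z ⊗ₜ e)) fun e₁ z₁ => sweedler₂ (J (l ⊗ₜ e₁)) fun e₂ l₁ =>
        sweedler₂ (J (n ⊗ₜ e₂)) fun e₃ n₁ => sweedler₂ (J (y ⊗ₜ e₃)) fun e₄ y₁ =>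
        sweedler₃ (η (d₁ ⊗ₜ e₄)) fun p q r => p ⊗ₜ[k] (q * (y₁ * n₁ * l₁ * z₁) * f * m * r) := by
      simp only [hax5.sweedler]
    _ = sweedler₂ (T (a ⊗ₜ h')) fun a₁ l => sweedler₃ (η (a₁ ⊗ₜ v)) fun x y z =>
        sweedler₃ (γ (x ⊗ₜ u'')) fun d e f => sweedler₂ (J (z ⊗ₜ e)) fun e₁ z₁ =>
        sweedler₂ (T (d ⊗ₜ h'')) fun d₁ m => sweedler₂ (J (l ⊗ₜ e₁)) fun e₂ l₁ =>
        sweedler₂ (J (n ⊗ₜ e₂)) fun e₃ n₁ => sweedler₂ (J (y ⊗ₜ e₃)) fun e₄ y₁ =>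
        sweedler₃ (η (d₁ ⊗ₜ e₄)) fun p q r => p ⊗ₜ[k] (q * (y₁ * n₁ * l₁ * z₁) * f * m * r) := by
      refine sweedler₂_congr fun _ _ => ?_
      refine sweedler₃_congr fun _ _ _ => ?_
      refine sweedler₃_congr fun _ _ _ => ?_
      exact sweedler₂_comm _ _ _
    _ = sweedler₂ (T (a ⊗ₜ h')) fun a₁ l => sweedler₃ (γ (v ⊗ₜ u'')) fun A B C =>
        sweedler₃ (γ (a₁ ⊗ₜ B)) fun d e g => sweedler₂ (T (d ⊗ₜ C)) fun d₁ c =>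
        sweedler₃ (η (d₁ ⊗ₜ A)) fun x y z => sweedler₂ (T (x ⊗ₜ h'')) fun x₁ m =>
        sweedler₂ (J (l ⊗ₜ e)) fun e₂ l₁ => sweedler₂ (J (n ⊗ₜ e₂)) fun e₃ n₁ =>
        sweedler₂ (J (y ⊗ₜ e₃)) fun e₄ y₁ => sweedler₃ (η (x₁ ⊗ₜ e₄)) fun p q r =>
        p ⊗ₜ[k] (q * y₁ * n₁ * l₁ * g * c * z * m * r) := by
      refine sweedler₂_congr fun a₁ l => ?_
      simpa only [mul_assoc] using
            (hax12.sweedler a₁ v u'' (fun d e y g => sweedler₂ (T (d ⊗ₜ h'')) fun x₁ m =>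
              sweedler₂ (J (l ⊗ₜ e)) fun e₂ l₁ => sweedler₂ (J (n ⊗ₜ e₂)) fun e₃ n₁ =>
              sweedler₂ (J (y ⊗ₜ e₃)) fun e₄ y₁ => sweedler₃ (η (x₁ ⊗ₜ e₄)) fun p q r =>
              p ⊗ₜ[k] (q * y₁ * n₁ * l₁ * g * m * r)))
    _ = sweedler₃ (γ (v ⊗ₜ u'')) fun A B C => sweedler₂ (T (a ⊗ₜ h')) fun a₁ l =>
        sweedler₃ (γ (a₁ ⊗ₜ B)) fun d e g => sweedler₂ (T (d ⊗ₜ C)) fun d₁ c =>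
        sweedler₃ (η (d₁ ⊗ₜ A)) fun x y z => sweedler₂ (T (x ⊗ₜ h'')) fun x₁ m =>
        sweedler₂ (J (l ⊗ₜ e)) fun e₂ l₁ => sweedler₂ (J (n ⊗ₜ e₂)) fun e₃ n₁ =>
        sweedler₂ (J (y ⊗ₜ e₃)) fun e₄ y₁ => sweedler₃ (η (x₁ ⊗ₜ e₄)) fun p q r =>
        p ⊗ₜ[k] (q * y₁ * n₁ * l₁ * g * c * z * m * r) := by
      exact sweedler₂_sweedler₃_comm _ _ _
    _ = sweedler₃ (γ (v ⊗ₜ u'')) fun A B C => sweedler₂ (T (a ⊗ₜ h')) fun a₁ l =>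
        sweedler₃ (γ (a₁ ⊗ₜ B)) fun d e g => sweedler₂ (J (l ⊗ₜ e)) fun e₂ l₁ =>
        sweedler₂ (T (d ⊗ₜ C)) fun d₁ c => sweedler₃ (η (d₁ ⊗ₜ A)) fun x y z =>
        sweedler₂ (T (x ⊗ₜ h'')) fun x₁ m => sweedler₂ (J (n ⊗ₜ e₂)) fun e₃ n₁ =>
        sweedler₂ (J (y ⊗ₜ e₃)) fun e₄ y₁ => sweedler₃ (η (x₁ ⊗ₜ e₄)) fun p q r =>
        p ⊗ₜ[k] (q * y₁ * n₁ * l₁ * g * c * z * m * r) := by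
      refine sweedler₃_congr fun _ _ _ => ?_
      refine sweedler₂_congr fun _ _ => ?_
      refine sweedler₃_congr fun _ _ _ => ?_
      refine Eq.trans ?_ (sweedler₂_comm _ _ _)
      refine sweedler₂_congr fun _ _ => ?_
      refine Eq.trans ?_ ((sweedler₂_sweedler₃_comm _ _ _).symm)
      refine sweedler₃_congr fun _ _ _ => ?_
      exact sweedler₂_comm _ _ _
    _ = sweedler₃ (γ (v ⊗ₜ u'')) fun A B C => sweedler₂ (J (h' ⊗ₜ B)) fun B₁ l =>
        sweedler₃ (γ (a ⊗ₜ B₁)) fun d e g => sweedler₂ (T (d ⊗ₜ l)) fun d₁ l₁ =>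
        sweedler₂ (T (d₁ ⊗ₜ C)) fun d₂ c => sweedler₃ (η (d₂ ⊗ₜ A)) fun x y z =>
        sweedler₂ (T (x ⊗ₜ h'')) fun x₁ m => sweedler₂ (J (n ⊗ₜ e)) fun e₁ n₁ =>
        sweedler₂ (J (y ⊗ₜ e₁)) fun e₂ y₁ => sweedler₃ (η (x₁ ⊗ₜ e₂)) fun p q r =>
        p ⊗ₜ[k] (q * y₁ * n₁ * g * l₁ * c * z * m * r) := by
      refine sweedler₃_congr fun A B C => ?_
      simpa only [mul_assoc] using
            (hax10.sweedler a _ h' (fun d e g => sweedler₂ (T (d ⊗ₜ C)) fun d₂ c =>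
              sweedler₃ (η (d₂ ⊗ₜ A)) fun x y z => sweedler₂ (T (x ⊗ₜ h'')) fun x₁ m =>
              sweedler₂ (J (n ⊗ₜ e)) fun e₁ n₁ => sweedler₂ (J (y ⊗ₜ e₁)) fun e₂ y₁ =>
              sweedler₃ (η (x₁ ⊗ₜ e₂)) fun p q r => p ⊗ₜ[k] (q * y₁ * n₁ * g * c * z * m * r))).symm
    _ = sweedler₃ (γ (v ⊗ₜ u'')) fun A B C => sweedler₂ (J (h' ⊗ₜ B)) fun B₁ l =>
        sweedler₃ (γ (a ⊗ₜ B₁)) fun d e g => sweedler₂ (T (d ⊗ₜ l)) fun d₁ l₁ =>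
        sweedler₂ (T (d₁ ⊗ₜ C)) fun d₂ c => sweedler₂ (T (A ⊗ₜ h'')) fun A₁ m =>
        sweedler₂ (T (d₂ ⊗ₜ m)) fun d₃ m₁ => sweedler₃ (η (d₃ ⊗ₜ A₁)) fun x y z =>
        sweedler₂ (J (n ⊗ₜ e)) fun e₁ n₁ => sweedler₂ (J (y ⊗ₜ e₁)) fun e₂ y₁ =>
        sweedler₃ (η (x ⊗ₜ e₂)) fun p q r => p ⊗ₜ[k] (q * y₁ * n₁ * g * l₁ * c * m₁ * z * r) := by
      refine sweedler₃_congr fun A B C => ?_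
      refine sweedler₂_congr fun B₁ l => ?_
      refine sweedler₃_congr fun d e g => ?_
      refine sweedler₂_congr fun d₁ l₁ => ?_
      refine sweedler₂_congr fun d₂ c => ?_
      simpa only [mul_assoc] using
            (hax8.sweedler _ _ h'' (fun x y z => sweedler₂ (J (n ⊗ₜ e)) fun e₁ n₁ =>
              sweedler₂ (J (y ⊗ₜ e₁)) fun e₂ y₁ => sweedler₃ (η (x ⊗ₜ e₂)) fun p q r =>
              p ⊗ₜ[k] (q * y₁ * n₁ * g * l₁ * c * z * r))).symm
    _ = sweedler₃ (γ (v ⊗ₜ u'')) fun A B C => sweedler₂ (T (A ⊗ₜ h'')) fun A₁ m =>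
        sweedler₂ (J (h' ⊗ₜ B)) fun B₁ l => sweedler₃ (γ (a ⊗ₜ B₁)) fun d e g =>
        sweedler₂ (T (d ⊗ₜ l)) fun d₁ l₁ => sweedler₂ (T (d₁ ⊗ₜ C)) fun d₂ c =>
        sweedler₂ (T (d₂ ⊗ₜ m)) fun d₃ m₁ => sweedler₃ (η (d₃ ⊗ₜ A₁)) fun x y z =>
        sweedler₂ (J (n ⊗ₜ e)) fun e₁ n₁ => sweedler₂ (J (y ⊗ₜ e₁)) fun e₂ y₁ =>
        sweedler₃ (η (x ⊗ₜ e₂)) fun p q r => p ⊗ₜ[k] (q * y₁ * n₁ * g * l₁ * c * m₁ * z * r) := by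
      refine sweedler₃_congr fun _ _ _ => ?_
      refine Eq.trans ?_ (sweedler₂_comm _ _ _)
      refine sweedler₂_congr fun _ _ => ?_
      refine Eq.trans ?_ ((sweedler₂_sweedler₃_comm _ _ _).symm)
      refine sweedler₃_congr fun _ _ _ => ?_
      refine Eq.trans ?_ (sweedler₂_comm _ _ _)
      refine sweedler₂_congr fun _ _ => ?_
      exact sweedler₂_comm _ _ _
    _ = sweedler₃ (γ (v ⊗ₜ u'')) fun A B C => sweedler₂ (T (A ⊗ₜ h'')) fun A₁ m =>
        sweedler₂ (J (h' ⊗ₜ B)) fun B₁ l => sweedler₃ (γ (a ⊗ₜ B₁)) fun d e g =>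
        sweedler₂ (J (n ⊗ₜ e)) fun e₁ n₁ => sweedler₂ (T (d ⊗ₜ l)) fun d₁ l₁ =>
        sweedler₂ (T (d₁ ⊗ₜ C)) fun d₂ c => sweedler₂ (T (d₂ ⊗ₜ m)) fun d₃ m₁ =>
        sweedler₃ (η (d₃ ⊗ₜ A₁)) fun x y z => sweedler₂ (J (y ⊗ₜ e₁)) fun e₂ y₁ =>
        sweedler₃ (η (x ⊗ₜ e₂)) fun p q r => p ⊗ₜ[k] (q * y₁ * n₁ * g * l₁ * c * m₁ * z * r) := by
      refine sweedler₃_congr fun _ _ _ => ?_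
      refine sweedler₂_congr fun _ _ => ?_
      refine sweedler₂_congr fun _ _ => ?_
      refine sweedler₃_congr fun _ _ _ => ?_
      refine Eq.trans ?_ (sweedler₂_comm _ _ _)
      refine sweedler₂_congr fun _ _ => ?_
      refine Eq.trans ?_ (sweedler₂_comm _ _ _)
      refine sweedler₂_congr fun _ _ => ?_
      refine Eq.trans ?_ (sweedler₂_comm _ _ _)
      refine sweedler₂_congr fun _ _ => ?_
      exact (sweedler₂_sweedler₃_comm _ _ _).symm
    _ = sweedler₃ (γ (v ⊗ₜ u'')) fun A B C => sweedler₂ (T (A ⊗ₜ h'')) fun A₁ m =>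
        sweedler₂ (J (h' ⊗ₜ B)) fun B₁ l => sweedler₃ (γ (a ⊗ₜ B₁)) fun d e g =>
        sweedler₂ (J (n ⊗ₜ e)) fun e₁ n₁ => sweedler₂ (T (d ⊗ₜ l)) fun d₁ l₁ =>
        sweedler₂ (T (d₁ ⊗ₜ C)) fun d₂ c => sweedler₂ (T (d₂ ⊗ₜ m)) fun d₃ m₁ =>
        sweedler₃ (η (A₁ ⊗ₜ e₁)) fun s v w => sweedler₂ (T (d₃ ⊗ₜ w)) fun d₄ w₁ =>
        sweedler₃ (η (d₄ ⊗ₜ s)) fun p q r => p ⊗ₜ[k] (q * v * n₁ * g * l₁ * c * m₁ * w₁ * r) := by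
      refine sweedler₃_congr fun A B C => ?_
      refine sweedler₂_congr fun A₁ m => ?_
      refine sweedler₂_congr fun B₁ l => ?_
      refine sweedler₃_congr fun d e g => ?_
      refine sweedler₂_congr fun e₁ n₁ => ?_
      refine sweedler₂_congr fun d₁ l₁ => ?_
      refine sweedler₂_congr fun d₂ c => ?_
      refine sweedler₂_congr fun d₃ m₁ => ?_
      simpa only [mul_assoc] using
            (hax9.sweedler _ _ _ (fun p q r => p ⊗ₜ[k] (q * n₁ * g * l₁ * c * m₁ * r)))
    _ = sweedler₃ (γ (v ⊗ₜ u'')) fun A B C => sweedler₂ (T (A ⊗ₜ h'')) fun A₁ m =>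
        sweedler₂ (J (h' ⊗ₜ B)) fun B₁ l => sweedler₃ (γ (a ⊗ₜ B₁)) fun d e g =>
        sweedler₂ (J (n ⊗ₜ e)) fun e₁ n₁ => sweedler₃ (η (A₁ ⊗ₜ e₁)) fun s v w =>
        sweedler₂ (T (d ⊗ₜ l)) fun d₁ l₁ => sweedler₂ (T (d₁ ⊗ₜ C)) fun d₂ c =>
        sweedler₂ (T (d₂ ⊗ₜ m)) fun d₃ m₁ => sweedler₂ (T (d₃ ⊗ₜ w)) fun d₄ w₁ =>
        sweedler₃ (η (d₄ ⊗ₜ s)) fun p q r => p ⊗ₜ[k] (q * v * n₁ * g * l₁ * c * m₁ * w₁ * r) := by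
      refine sweedler₃_congr fun _ _ _ => ?_
      refine sweedler₂_congr fun _ _ => ?_
      refine sweedler₂_congr fun _ _ => ?_
      refine sweedler₃_congr fun _ _ _ => ?_
      refine sweedler₂_congr fun _ _ => ?_
      refine Eq.trans ?_ (sweedler₂_sweedler₃_comm _ _ _)
      refine sweedler₂_congr fun _ _ => ?_
      refine Eq.trans ?_ (sweedler₂_sweedler₃_comm _ _ _)
      refine sweedler₂_congr fun _ _ => ?_
      exact sweedler₂_sweedler₃_comm _ _ _
    _ = sweedler₃ (γ (v ⊗ₜ u'')) fun A B C => sweedler₂ (T (A ⊗ₜ h'')) fun A₁ m =>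
        lrTail J T γ η h' a A₁ n B (C * m) := by
      simp only [lrTail, hax6.sweedler, mul_assoc]

set_option synthInstance.maxHeartbeats 400000 in
set_option synthInstance.maxSize 100000 in
/-- The product `(u ⊗ h) * (x ⊗ h')` summed over the terms of the product of two pure tensors that
remain once `γ` and `T` have been expanded. -/
theorem lrM_lrM_right (hax5 : LRax5 k J) (hax6 : LRax6 k T) (hax7 : LRax7 k J η)
    (hax11 : LRax11 k J T γ η) (u v b : U) (h h' m : H) :
    (sweedler₂ (J (h' ⊗ₜ b)) fun b₁ l => sweedler₃ (η (v ⊗ₜ b₁)) fun x y z =>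
      lrM k J T γ η ((u ⊗ₜ h) ⊗ₜ (x ⊗ₜ (y * l * m * z)))) =
      sweedler₃ (γ (u ⊗ₜ v)) fun α β κ => sweedler₂ (J (h ⊗ₜ β)) fun β₁ h₁ =>
        lrTail J T γ η h' α β₁ (h₁ * κ) b m := by
  simp only [lrM_tmul]
  calc
    sweedler₂ (J (h' ⊗ₜ b)) fun b₁ l => sweedler₃ (η (v ⊗ₜ b₁)) fun x y z =>
        sweedler₃ (γ (u ⊗ₜ x)) fun d e g => sweedler₂ (T (d ⊗ₜ (y * l * m * z))) fun d₁ w =>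
        sweedler₂ (J (h ⊗ₜ e)) fun e₁ h₁ => sweedler₃ (η (d₁ ⊗ₜ e₁)) fun p q r =>
        p ⊗ₜ[k] (q * h₁ * g * w * r)
    _ = sweedler₂ (J (h' ⊗ₜ b)) fun b₁ l => sweedler₃ (η (v ⊗ₜ b₁)) fun x y z =>
        sweedler₃ (γ (u ⊗ₜ x)) fun d e g => sweedler₂ (T (d ⊗ₜ y)) fun d' y₁ =>
        sweedler₂ (T (d' ⊗ₜ (l * m * z))) fun d₁ w => sweedler₂ (J (h ⊗ₜ e)) fun e₁ h₁ =>
        sweedler₃ (η (d₁ ⊗ₜ e₁)) fun p q r => p ⊗ₜ[k] (q * h₁ * g * (y₁ * w) * r) := by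
      refine sweedler₂_congr fun b₁ l => ?_
      refine sweedler₃_congr fun x y z => ?_
      refine sweedler₃_congr fun d e g => ?_
      rw [show y * l * m * z = y * (l * m * z) by simp only [mul_assoc], hax6.sweedler]
    _ = sweedler₂ (J (h' ⊗ₜ b)) fun b₁ l => sweedler₃ (γ (u ⊗ₜ v)) fun α β κ =>
        sweedler₃ (γ (α ⊗ₜ b₁)) fun d e g => sweedler₂ (J (κ ⊗ₜ e)) fun e₁ κ₁ =>
        sweedler₃ (η (β ⊗ₜ e₁)) fun x y z => sweedler₂ (T (d ⊗ₜ (l * m * z))) fun d₁ w =>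
        sweedler₂ (J (h ⊗ₜ x)) fun x₁ h₁ => sweedler₃ (η (d₁ ⊗ₜ x₁)) fun p q r =>
        p ⊗ₜ[k] (q * h₁ * y * κ₁ * g * w * r) := by
      refine sweedler₂_congr fun b₁ l => ?_
      simpa only [mul_assoc] using
            (hax11.sweedler u v _ (fun d e g z => sweedler₂ (T (d ⊗ₜ (l * m * z))) fun d₁ w =>
              sweedler₂ (J (h ⊗ₜ e)) fun e₁ h₁ => sweedler₃ (η (d₁ ⊗ₜ e₁)) fun p q r =>
              p ⊗ₜ[k] (q * h₁ * g * w * r)))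
    _ = sweedler₂ (J (h' ⊗ₜ b)) fun b₁ l => sweedler₃ (γ (u ⊗ₜ v)) fun α β κ =>
        sweedler₃ (γ (α ⊗ₜ b₁)) fun d e g => sweedler₂ (J (κ ⊗ₜ e)) fun e₁ κ₁ =>
        sweedler₃ (η (β ⊗ₜ e₁)) fun x y z => sweedler₂ (J (h ⊗ₜ x)) fun x₁ h₁ =>
        sweedler₂ (T (d ⊗ₜ (l * m * z))) fun d₁ w => sweedler₃ (η (d₁ ⊗ₜ x₁)) fun p q r =>
        p ⊗ₜ[k] (q * h₁ * y * κ₁ * g * w * r) := by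
      refine sweedler₂_congr fun _ _ => ?_
      refine sweedler₃_congr fun _ _ _ => ?_
      refine sweedler₃_congr fun _ _ _ => ?_
      refine sweedler₂_congr fun _ _ => ?_
      refine sweedler₃_congr fun _ _ _ => ?_
      exact sweedler₂_comm _ _ _
    _ = sweedler₂ (J (h' ⊗ₜ b)) fun b₁ l => sweedler₃ (γ (u ⊗ₜ v)) fun α β κ =>
        sweedler₃ (γ (α ⊗ₜ b₁)) fun d e g => sweedler₂ (J (κ ⊗ₜ e)) fun e₁ κ₁ =>
        sweedler₂ (J (h ⊗ₜ β)) fun β₁ h₁ => sweedler₂ (J (h₁ ⊗ₜ e₁)) fun e₂ h₂ =>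
        sweedler₃ (η (β₁ ⊗ₜ e₂)) fun x y z => sweedler₂ (T (d ⊗ₜ (l * m * z))) fun d₁ w =>
        sweedler₃ (η (d₁ ⊗ₜ x)) fun p q r => p ⊗ₜ[k] (q * y * h₂ * κ₁ * g * w * r) := by
      refine sweedler₂_congr fun b₁ l => ?_
      refine sweedler₃_congr fun α β κ => ?_
      refine sweedler₃_congr fun d e g => ?_
      refine sweedler₂_congr fun e₁ κ₁ => ?_
      simpa only [mul_assoc] using
            (hax7.sweedler h _ _ (fun x y z => sweedler₂ (T (d ⊗ₜ (l * m * z))) fun d₁ w =>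
              sweedler₃ (η (d₁ ⊗ₜ x)) fun p q r => p ⊗ₜ[k] (q * y * κ₁ * g * w * r))).symm
    _ = sweedler₃ (γ (u ⊗ₜ v)) fun α β κ => sweedler₂ (J (h' ⊗ₜ b)) fun b₁ l =>
        sweedler₃ (γ (α ⊗ₜ b₁)) fun d e g => sweedler₂ (J (κ ⊗ₜ e)) fun e₁ κ₁ =>
        sweedler₂ (J (h ⊗ₜ β)) fun β₁ h₁ => sweedler₂ (J (h₁ ⊗ₜ e₁)) fun e₂ h₂ =>
        sweedler₃ (η (β₁ ⊗ₜ e₂)) fun x y z => sweedler₂ (T (d ⊗ₜ (l * m * z))) fun d₁ w =>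
        sweedler₃ (η (d₁ ⊗ₜ x)) fun p q r => p ⊗ₜ[k] (q * y * h₂ * κ₁ * g * w * r) := by
      exact sweedler₂_sweedler₃_comm _ _ _
    _ = sweedler₃ (γ (u ⊗ₜ v)) fun α β κ => sweedler₂ (J (h ⊗ₜ β)) fun β₁ h₁ =>
        sweedler₂ (J (h' ⊗ₜ b)) fun b₁ l => sweedler₃ (γ (α ⊗ₜ b₁)) fun d e g =>
        sweedler₂ (J (κ ⊗ₜ e)) fun e₁ κ₁ => sweedler₂ (J (h₁ ⊗ₜ e₁)) fun e₂ h₂ =>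
        sweedler₃ (η (β₁ ⊗ₜ e₂)) fun x y z => sweedler₂ (T (d ⊗ₜ (l * m * z))) fun d₁ w =>
        sweedler₃ (η (d₁ ⊗ₜ x)) fun p q r => p ⊗ₜ[k] (q * y * h₂ * κ₁ * g * w * r) := by
      refine sweedler₃_congr fun _ _ _ => ?_
      refine Eq.trans ?_ (sweedler₂_comm _ _ _)
      refine sweedler₂_congr fun _ _ => ?_
      refine Eq.trans ?_ ((sweedler₂_sweedler₃_comm _ _ _).symm)
      refine sweedler₃_congr fun _ _ _ => ?_
      exact sweedler₂_comm _ _ _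
    _ = sweedler₃ (γ (u ⊗ₜ v)) fun α β κ => sweedler₂ (J (h ⊗ₜ β)) fun β₁ h₁ =>
        lrTail J T γ η h' α β₁ (h₁ * κ) b m := by
      simp only [lrTail, hax5.sweedler, mul_assoc]

end Axioms

section Main

set_option synthInstance.maxHeartbeats 400000
set_option synthInstance.maxSize 100000

variable {H U : Type*} [Ring H] [Algebra k H] [AddCommGroup U] [Module k U]
  {J : H ⊗[k] U →ₗ[k] U ⊗[k] H} {T : U ⊗[k] H →ₗ[k] U ⊗[k] H}
  {γ : U ⊗[k] U →ₗ[k] U ⊗[k] (U ⊗[k] H)} {η : U ⊗[k] U →ₗ[k] U ⊗[k] (H ⊗[k] H)}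

theorem lrMul_assoc_tmul (hax5 : LRax5 k J) (hax6 : LRax6 k T) (hax7 : LRax7 k J η)
    (hax8 : LRax8 k T η) (hax9 : LRax9 k J T η) (hax10 : LRax10 k J T γ)
    (hax11 : LRax11 k J T γ η) (hax12 : LRax12 k J T γ η) (hax13 : LRax13 k J T γ)
    (u u' u'' : U) (h h' h'' : H) :
    lrMul k J T γ η (lrMul k J T γ η (u ⊗ₜ h) (u' ⊗ₜ h')) (u'' ⊗ₜ h'') =
      lrMul k J T γ η (u ⊗ₜ h) (lrMul k J T γ η (u' ⊗ₜ h') (u'' ⊗ₜ h'')) := by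
  have key := hax13.sweedler u u' u'' h'' h fun a A₁ n B m => lrTail J T γ η h' a A₁ n B m
  simp only [lrMul]
  rw [lrM_tmul u u', lrM_tmul u' u'', map_sweedler₃ (k := k) fun t => lrM k J T γ η (t ⊗ₜ (u'' ⊗ₜ h'')),
    map_sweedler₃ (k := k) fun t => lrM k J T γ η ((u ⊗ₜ h) ⊗ₜ t)]
  refine Eq.trans ?_ (key.symm.trans ?_)
  · refine sweedler₃_congr fun a b c => ?_
    rw [sweedler₂_comm, map_sweedler₂ (k := k) fun t => lrM k J T γ η (t ⊗ₜ (u'' ⊗ₜ h''))]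
    refine sweedler₂_congr fun b₁ h₁ => ?_
    rw [← lrM_lrM_left hax5 hax6 hax8 hax9 hax10 hax12,
      map_sweedler₂ (k := k) fun t => lrM k J T γ η (t ⊗ₜ (u'' ⊗ₜ h''))]
    refine sweedler₂_congr fun a₁ l => ?_
    rw [map_sweedler₃ (k := k) fun t => lrM k J T γ η (t ⊗ₜ (u'' ⊗ₜ h''))]
    simp only [mul_assoc]
  · refine sweedler₃_congr fun a b c => ?_
    rw [map_sweedler₂ (k := k) fun t => lrM k J T γ η ((u ⊗ₜ h) ⊗ₜ t)]
    refine sweedler₂_congr fun a₁ l => ?_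
    rw [← lrM_lrM_right hax5 hax6 hax7 hax11,
      map_sweedler₂ (k := k) fun t => lrM k J T γ η ((u ⊗ₜ h) ⊗ₜ t)]
    refine sweedler₂_congr fun b₁ l => ?_
    rw [map_sweedler₃ (k := k) fun t => lrM k J T γ η ((u ⊗ₜ h) ⊗ₜ t)]
    simp only [mul_assoc]

theorem one_lrMul_tmul {oneU : U} (hax1 : LRax1 k J oneU) (hax2 : LRax2 k T oneU)
    (hax3 : LRax3 k γ oneU) (hax4 : LRax4 k η oneU) (u : U) (h : H) :
    lrMul k J T γ η (oneU ⊗ₜ 1) (u ⊗ₜ h) = u ⊗ₜ h := by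
  simp [lrMul, lrM_tmul, hax1.2, hax2.2, hax3.2, hax4.2]

theorem lrMul_one_tmul {oneU : U} (hax1 : LRax1 k J oneU) (hax2 : LRax2 k T oneU)
    (hax3 : LRax3 k γ oneU) (hax4 : LRax4 k η oneU) (u : U) (h : H) :
    lrMul k J T γ η (u ⊗ₜ h) (oneU ⊗ₜ 1) = u ⊗ₜ h := by
  simp [lrMul, lrM_tmul, hax1.1, hax2.1, hax3.1, hax4.1]

end Main

/-- Given an associative unital `k`-algebra `H`, a `k`-vector space `U` with a
distinguished element `1_U`, and linear maps `J`, `T`, `γ`, `η` satisfying the L-R-crossed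
product axioms (1)-(13), the L-R-crossed product multiplication on `U ⊗ H` is associative and
has `1_U ⊗ 1_H` as a two-sided unit, i.e. `U ⊗ H` becomes an associative unital `k`-algebra. -/
theorem lr_crossed_product_is_unital_associative_algebra
    {k : Type*} [Field k] {H U : Type*} [Ring H] [Algebra k H]
    [AddCommGroup U] [Module k U] (oneU : U)
    (J : H ⊗[k] U →ₗ[k] U ⊗[k] H) (T : U ⊗[k] H →ₗ[k] U ⊗[k] H)
    (γ : U ⊗[k] U →ₗ[k] U ⊗[k] (U ⊗[k] H))
    (η : U ⊗[k] U →ₗ[k] U ⊗[k] (H ⊗[k] H))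
    (hax1 : LRax1 k J oneU) (hax2 : LRax2 k T oneU)
    (hax3 : LRax3 k γ oneU) (hax4 : LRax4 k η oneU)
    (hax5 : LRax5 k J) (hax6 : LRax6 k T)
    (hax7 : LRax7 k J η) (hax8 : LRax8 k T η)
    (hax9 : LRax9 k J T η) (hax10 : LRax10 k J T γ)
    (hax11 : LRax11 k J T γ η) (hax12 : LRax12 k J T γ η)
    (hax13 : LRax13 k J T γ) :
    (∀ x y z : U ⊗[k] H,
        lrMul k J T γ η (lrMul k J T γ η x y) z = lrMul k J T γ η x (lrMul k J T γ η y z)) ∧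
    (∀ x : U ⊗[k] H, lrMul k J T γ η (oneU ⊗ₜ (1 : H)) x = x) ∧
    (∀ x : U ⊗[k] H, lrMul k J T γ η x (oneU ⊗ₜ (1 : H)) = x) := by
  refine ⟨fun x y z => ?_, fun x => ?_, fun x => ?_⟩
  · induction x using TensorProduct.induction_on with
    | zero => simp [lrMul]
    | add x₁ x₂ h₁ h₂ => simp_all [lrMul, add_tmul]
    | tmul u h =>
      induction y using TensorProduct.induction_on with
      | zero => simp [lrMul]
      | add y₁ y₂ h₁ h₂ => simp_all [lrMul, add_tmul, tmul_add]
      | tmul u' h' =>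
        induction z using TensorProduct.induction_on with
        | zero => simp [lrMul]
        | add z₁ z₂ h₁ h₂ => simp_all [lrMul, tmul_add]
        | tmul u'' h'' =>
          exact lrMul_assoc_tmul hax5 hax6 hax7 hax8 hax9 hax10 hax11 hax12 hax13 _ _ _ _ _ _
  · induction x using TensorProduct.induction_on with
    | zero => simp [lrMul]
    | add x₁ x₂ h₁ h₂ => simp_all [lrMul, tmul_add]
    | tmul u h => exact one_lrMul_tmul hax1 hax2 hax3 hax4 u h
  · induction x using TensorProduct.induction_on with
    | zero => simp [lrMul]
    | add x₁ x₂ h₁ h₂ => simp_all [lrMul, add_tmul]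
    | tmul u h => exact lrMul_one_tmul hax1 hax2 hax3 hax4 u h
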